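/- arXiv:1004.0994 — 2 statements merged into one kernel-verified Lean document; each statement's English description precedes it below -/
import Mathlib

section
/- Let F be a field with char F ≠ 2 and let a, b ∈ F be nonzero. Then the quaternion algebra ℍ[F, a, b] is isomorphic as an F-algebra to the algebra of 2×2 matrices over F if and only if there exist u, v ∈ F with u² − a·v² = b (i.e., b is a norm from the quadratic algebra F[i] = F ⊕ F·i with i² = a). -/
open Quaternion

namespace QuaternionAlgebra

/-- If `b = u² - a v²`, the matrices `!![0, a; 1, 0]` and `!![u, -a v; v, -u]` satisfy the relations
of the generators of `ℍ[F, a, b]`. -/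
def matrixBasis {F : Type*} [CommRing F] {a b u v : F} (h : u ^ 2 - a * v ^ 2 = b) :
    Basis (Matrix (Fin 2) (Fin 2) F) a 0 b where
  i := !![0, a; 1, 0]
  j := !![u, -(a * v); v, -u]
  k := !![0, a; 1, 0] * !![u, -(a * v); v, -u]
  i_mul_i := by
    ext i j; fin_cases i <;> fin_cases j <;> simp
  j_mul_j := by
    subst h
    ext i j; fin_cases i <;> fin_cases j <;> simp <;> ring
  i_mul_j := rfl
  j_mul_i := by
    ext i j; fin_cases i <;> fin_cases j <;> simp <;> ring

theorem matrixBasis_liftHom_injective {F : Type*} [Field F] (h2 : (2 : F) ≠ 0) {a b u v : F}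
    (ha : a ≠ 0) (hb : b ≠ 0) (h : u ^ 2 - a * v ^ 2 = b) :
    Function.Injective (matrixBasis h).liftHom := by
  rw [injective_iff_map_eq_zero]
  rintro ⟨r, p, q, s⟩ hx
  have entry (i j : Fin 2) := congrFun (congrFun hx i) j
  have h00 := entry 0 0
  have h01 := entry 0 1
  have h10 := entry 1 0
  have h11 := entry 1 1
  simp [Basis.lift, matrixBasis, Matrix.algebraMap_matrix_apply] at h00 h01 h10 h11
  have hr : r = 0 := (mul_eq_zero_iff_left h2).1 (by linear_combination h00 + h11)
  subst hr
  have hp : p = 0 :=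
    (mul_eq_zero_iff_left (mul_ne_zero h2 ha)).1 (by linear_combination h01 + a * h10)
  subst hp
  have hq : q = 0 := (mul_eq_zero_iff_left hb).1
    (by rw [← h]; linear_combination u * h00 - a * v * h10)
  have hs : s = 0 := (mul_eq_zero_iff_left hb).1
    (by rw [← h]; linear_combination u * h10 - v * h00)
  subst hq hs
  rfl

theorem nonempty_algEquiv_matrix_of_isNorm {F : Type*} [Field F] (h2 : (2 : F) ≠ 0) {a b u v : F}
    (ha : a ≠ 0) (hb : b ≠ 0) (h : u ^ 2 - a * v ^ 2 = b) :
    Nonempty (ℍ[F, a, b] ≃ₐ[F] Matrix (Fin 2) (Fin 2) F) := by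
  have hinj := matrixBasis_liftHom_injective h2 ha hb h
  have hdim : Module.finrank F ℍ[F, a, b] = Module.finrank F (Matrix (Fin 2) (Fin 2) F) := by
    simp [finrank_eq_four, Module.finrank_matrix]
  exact ⟨AlgEquiv.ofBijective _
    ⟨hinj, (LinearMap.injective_iff_surjective_of_finrank_eq_finrank
      (f := (matrixBasis h).liftHom.toLinearMap) hdim).1 hinj⟩⟩

theorem exists_isNorm_of_sq_eq_zero {F : Type*} [Field F] (h2 : (2 : F) ≠ 0) {a b : F}
    (ha : a ≠ 0) {x : ℍ[F, a, b]} (hx : x ≠ 0) (hxx : x * x = 0) :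
    ∃ u v : F, u ^ 2 - a * v ^ 2 = b := by
  by_cases hsq : IsSquare a
  · obtain ⟨t, rfl⟩ := hsq
    have ht : t ≠ 0 := left_ne_zero_of_mul ha
    exact ⟨(b + 1) / 2, (b - 1) / (2 * t), by field_simp; ring⟩
  obtain ⟨r, p, q, s⟩ := x
  simp only [mk_mul_mk, QuaternionAlgebra.ext_iff, re_zero, imI_zero, imJ_zero, imK_zero] at hxx
  obtain ⟨e, ei, ej, ek⟩ := hxx
  have hr : r = 0 := by
    by_contra hr
    have h2r := mul_ne_zero h2 hr
    have hp : p = 0 := (mul_eq_zero_iff_left h2r).1 (by linear_combination ei)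
    have hq : q = 0 := (mul_eq_zero_iff_left h2r).1 (by linear_combination ej)
    have hs : s = 0 := (mul_eq_zero_iff_left h2r).1 (by linear_combination ek)
    subst hp hq hs
    exact hr (by simpa using e)
  subst hr
  have hD : q ^ 2 - a * s ^ 2 ≠ 0 := by
    intro hD
    have hs : s = 0 := by
      by_contra hs
      exact hsq ⟨q / s, by field_simp; linear_combination -hD⟩
    subst hs
    have hq : q = 0 := by simpa using hD
    subst hq
    have hp : p = 0 := by simpa [ha] using e
    subst hp
    exact hx rfl
  refine ⟨p * a * s / (q ^ 2 - a * s ^ 2), p * q / (q ^ 2 - a * s ^ 2), ?_⟩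
  field_simp
  linear_combination -(q ^ 2 - a * s ^ 2) * e

end QuaternionAlgebra

/-- Let `F` be a field with `char F ≠ 2` and let `a, b ∈ F` be
nonzero.  Then `ℍ[F, a, b] ≅ M₂(F)` as `F`-algebras if and only if `b` is a norm from
the quadratic algebra `F[i] = F ⊕ F·i` with `i² = a`, i.e. there exist `u, v ∈ F` with
`u² − a·v² = b`. -/
theorem quaternionAlgebra_isMatrixRing_iff_isNorm
    (F : Type*) [Field F] (hchar : (ringChar F) ≠ 2)
    (a b : F) (ha : a ≠ 0) (hb : b ≠ 0) :
    Nonempty (ℍ[F, a, b] ≃ₐ[F] Matrix (Fin 2) (Fin 2) F) ↔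
      ∃ u v : F, u ^ 2 - a * v ^ 2 = b := by
  have h2 : (2 : F) ≠ 0 := Ring.two_ne_zero hchar
  refine ⟨fun ⟨e⟩ ↦ ?_, fun ⟨u, v, h⟩ ↦
    QuaternionAlgebra.nonempty_algEquiv_matrix_of_isNorm h2 ha hb h⟩
  have hne : (!![0, 1; 0, 0] : Matrix (Fin 2) (Fin 2) F) ≠ 0 := fun h ↦ by
    simpa using congrFun (congrFun h 0) 1
  refine QuaternionAlgebra.exists_isNorm_of_sq_eq_zero h2 ha
    (x := e.symm !![0, 1; 0, 0]) (by simpa using hne) ?_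
  rw [← map_mul, map_eq_zero_iff _ e.symm.injective]
  ext i j; fin_cases i <;> fin_cases j <;> simp
end

section
/- Let a, b be positive integers with b odd such that the Jacobi symbol J(a | b) = 1. Let ℓ be an odd prime such that ℓ·b is a square unit modulo a (i.e., there is a unit c of ℤ/aℤ with c² equal to the class of ℓ·b) and such that the Legendre symbol (a/ℓ) = 1. Then the quaternion algebra ℍ[ℚ, a, ℓ·b] is isomorphic as a ℚ-algebra to the 2×2 matrix algebra over ℚ if and only if for every prime p dividing b to odd exponent, a is a square modulo p. -/
open Quaternion

open scoped NumberTheorySymbols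

/-- If `a` and `B` are coprime positive integers, each a square modulo the other, then `B` is a
norm from `ℚ(√a)`. -/
theorem exists_eq_sq_sub_mul_sq_of_coprime {a B : ℕ} (ha : 0 < a) (hB : 0 < B)
    (hco : a.Coprime B) (hs : IsSquare (a : ZMod B)) (ht : IsSquare (B : ZMod a)) :
    ∃ u v : ℚ, (B : ℚ) = u ^ 2 - a * v ^ 2 := by
  by_cases hsqa : IsSquare a
  · obtain ⟨r, rfl⟩ := hsqa
    have hr : (r : ℚ) ≠ 0 := by
      rintro h
      simp_all
    refine ⟨(B + 1) / 2, (B - 1) / (2 * r), ?_⟩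
    push_cast
    field_simp
    ring
  have hnsq {x z : ℤ} (h : z ^ 2 = a * x ^ 2) : x = 0 := by
    by_contra hx
    apply hsqa
    rw [← Int.isSquare_natCast_iff, ← Rat.isSquare_intCast_iff]
    refine ⟨z / x, ?_⟩
    have hx' : (x : ℚ) ≠ 0 := by exact_mod_cast hx
    have h' : (z : ℚ) ^ 2 = a * x ^ 2 := by exact_mod_cast h
    push_cast
    field_simp
    linarith
  have : NeZero a := ⟨ha.ne'⟩
  have : NeZero B := ⟨hB.ne'⟩
  obtain ⟨s, hs⟩ := hs
  obtain ⟨t, ht⟩ := ht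
  let S := Finset.range (Nat.sqrt B + 1) ×ˢ Finset.range (Nat.sqrt a + 1) ×ˢ
    Finset.range (Nat.sqrt (a * B) + 1)
  let f : ℕ × ℕ × ℕ → ZMod B × ZMod a := fun q ↦ (q.2.2 - s * q.1, q.2.2 - t * q.2.1)
  have hcard : (Finset.univ : Finset (ZMod B × ZMod a)).card < S.card := by
    simp only [S, Finset.card_product, Finset.card_range, Finset.card_univ, Fintype.card_prod,
      ZMod.card]
    have h1 := Nat.lt_succ_sqrt' B
    have h2 := Nat.lt_succ_sqrt' a
    have h3 := Nat.lt_succ_sqrt' (a * B)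
    refine lt_of_pow_lt_pow_left₀ 2 (Nat.zero_le _) ?_
    calc (B * a) ^ 2 = B * (a * (a * B)) := by ring
      _ < (B.sqrt + 1) ^ 2 * ((a.sqrt + 1) ^ 2 * ((a * B).sqrt + 1) ^ 2) := by
        simp only [Nat.succ_eq_add_one] at h1 h2 h3
        gcongr
      _ = _ := by ring
  obtain ⟨⟨x₁, y₁, z₁⟩, h₁, ⟨x₂, y₂, z₂⟩, h₂, hne, heq⟩ :=
    Finset.exists_ne_map_eq_of_card_lt_of_maps_to hcard (f := f) (fun _ _ ↦ Finset.mem_univ _)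
  simp only [S, Finset.mem_product, Finset.mem_range] at h₁ h₂
  simp only [f, Prod.mk.injEq] at heq
  obtain ⟨heqB, heqa⟩ := heq
  have bound {n p q : ℕ} (hp : p < n.sqrt + 1) (hq : q < n.sqrt + 1) :
      ((p : ℤ) - q) ^ 2 ≤ n := by
    have h : |(p : ℤ) - q| ≤ n.sqrt := abs_le.2 ⟨by omega, by omega⟩
    have h' : ((n.sqrt : ℤ)) ^ 2 ≤ n := by exact_mod_cast Nat.sqrt_le' n
    exact (sq_le_sq' (abs_le.1 h).1 (abs_le.1 h).2).trans h'
  have hx := bound h₁.1 h₂.1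
  have hy := bound h₁.2.1 h₂.2.1
  have hz := bound h₁.2.2 h₂.2.2
  have hne' : ¬ ((x₁ : ℤ) - x₂ = 0 ∧ (y₁ : ℤ) - y₂ = 0 ∧ (z₁ : ℤ) - z₂ = 0) := by
    rintro ⟨hx0, hy0, hz0⟩
    apply hne
    simp only [Prod.mk.injEq]
    omega
  have hxB : (((z₁ : ℤ) - z₂ : ℤ) : ZMod B) = s * ((x₁ : ℤ) - x₂ : ℤ) := by
    push_cast
    linear_combination heqB
  have hya : (((z₁ : ℤ) - z₂ : ℤ) : ZMod a) = t * ((y₁ : ℤ) - y₂ : ℤ) := by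
    push_cast
    linear_combination heqa
  generalize (x₁ : ℤ) - x₂ = x at *
  generalize (y₁ : ℤ) - y₂ = y at *
  generalize (z₁ : ℤ) - z₂ = z at *
  have hdB : (B : ℤ) ∣ z ^ 2 - a * x ^ 2 - B * y ^ 2 := by
    rw [← ZMod.intCast_zmod_eq_zero_iff_dvd]
    push_cast
    rw [hxB, hs, ZMod.natCast_self]
    ring
  have hda : (a : ℤ) ∣ z ^ 2 - a * x ^ 2 - B * y ^ 2 := by
    rw [← ZMod.intCast_zmod_eq_zero_iff_dvd]
    push_cast
    rw [hya, ht, ZMod.natCast_self]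
    ring
  obtain ⟨k, hk⟩ := (Nat.isCoprime_iff_coprime.2 hco).mul_dvd hda hdB
  have ha' : (0 : ℤ) < a := by exact_mod_cast ha
  have hB' : (0 : ℤ) < B := by exact_mod_cast hB
  have hy_ne : y ^ 2 ≠ a := fun h ↦ one_ne_zero (hnsq (x := 1) (z := y) (by rw [h]; ring))
  have hy_lt : y ^ 2 < a := lt_of_le_of_ne hy hy_ne
  push_cast at hz
  have hab : (0 : ℤ) < a * B := mul_pos ha' hB'
  have hax : (a : ℤ) * x ^ 2 ≤ a * B := by gcongr
  have hax0 : (0 : ℤ) ≤ a * x ^ 2 := by positivity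
  have hBy : (B : ℤ) * y ^ 2 < B * a := by gcongr
  have hBy0 : (0 : ℤ) ≤ B * y ^ 2 := by positivity
  have hk1 : k < 2 := by nlinarith [sq_nonneg z]
  have hk2 : -2 < k := by nlinarith [sq_nonneg z]
  have hk' : (z : ℚ) ^ 2 - a * x ^ 2 - B * y ^ 2 = a * B * k := by exact_mod_cast hk
  interval_cases k
  · have hD : (y : ℚ) ^ 2 - a ≠ 0 := by
      rw [sub_ne_zero]
      exact_mod_cast hy_ne
    refine ⟨(z * y + a * x) / (y ^ 2 - a), (z + x * y) / (y ^ 2 - a), ?_⟩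
    field_simp
    push_cast at hk'
    linear_combination (-(y : ℚ) ^ 2 + a) * hk'
  · have hy0 : y ≠ 0 := by
      rintro rfl
      have hx0 : x = 0 := hnsq (z := z) (by linarith)
      subst hx0
      exact hne' ⟨rfl, rfl, by simpa using hk⟩
    have hy0' : (y : ℚ) ≠ 0 := by exact_mod_cast hy0
    refine ⟨z / y, x / y, ?_⟩
    field_simp
    push_cast at hk'
    linarith
  · exfalso
    have hzz : z ^ 2 = a * B := by linarith
    obtain ⟨r, hr⟩ := Int.sq_of_isCoprime (Nat.isCoprime_iff_coprime.2 hco) hzz.symm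
    rcases hr with hr | hr
    · exact one_ne_zero (hnsq (x := 1) (z := r) (by rw [hr]; ring))
    · nlinarith [sq_nonneg r]

/-- Infinite descent at a prime `p` exactly dividing `B` modulo which `a` is not a square. -/
theorem eq_zero_of_mul_sq_eq_sq_sub_mul_sq {p a B : ℕ} (hp : p.Prime) (hpB : p ∣ B)
    (hpB2 : ¬ p ^ 2 ∣ B) (ha : ¬ IsSquare (a : ZMod p)) {u v w : ℤ}
    (h : (B : ℤ) * w ^ 2 = u ^ 2 - a * v ^ 2) : w = 0 := by
  have : Fact p.Prime := ⟨hp⟩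
  have hp' : Prime (p : ℤ) := Nat.prime_iff_prime_int.1 hp
  induction hn : w.natAbs using Nat.strong_induction_on generalizing u v w with
  | _ n ih =>
    by_contra hw
    have hmod : (u : ZMod p) ^ 2 = a * (v : ZMod p) ^ 2 := by
      have hB0 : (B : ZMod p) = 0 := (ZMod.natCast_eq_zero_iff _ _).2 hpB
      have h' := congrArg (Int.cast : ℤ → ZMod p) h
      push_cast at h'
      rw [hB0] at h'
      linear_combination -h'
    have hv : (v : ZMod p) = 0 := by
      by_contra hv
      refine ha ⟨u / v, ?_⟩
      field_simp
      exact hmod.symm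
    have hu : (u : ZMod p) = 0 := by simpa [hv] using hmod
    rw [ZMod.intCast_zmod_eq_zero_iff_dvd] at hu hv
    obtain ⟨u, rfl⟩ := hu
    obtain ⟨v, rfl⟩ := hv
    obtain ⟨B', rfl⟩ := hpB
    have hB' : ¬ (p : ℤ) ∣ B' := by
      rw [Int.natCast_dvd_natCast]
      intro hd
      exact hpB2 (by rw [sq]; exact mul_dvd_mul_left p hd)
    have hpw : (p : ℤ) ∣ w := by
      have hd : (p : ℤ) ∣ B' * w ^ 2 := by
        refine ⟨u ^ 2 - a * v ^ 2, mul_left_cancel₀ hp'.ne_zero ?_⟩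
        push_cast at h
        linear_combination h
      exact hp'.dvd_of_dvd_pow ((hp'.dvd_or_dvd hd).resolve_left hB')
    obtain ⟨w, rfl⟩ := hpw
    have hw0 : w ≠ 0 := right_ne_zero_of_mul hw
    refine hw0 (ih w.natAbs ?_ (u := u) (v := v) ?_ rfl)
    · rw [← hn, Int.natAbs_mul, Int.natAbs_natCast]
      exact lt_mul_of_one_lt_left (Int.natAbs_pos.2 hw0) hp.one_lt
    · refine mul_left_cancel₀ (pow_ne_zero 2 hp'.ne_zero) ?_
      linear_combination h

/-- A quaternion algebra over `F` whose second parameter is a norm `u² - a v²` is split. -/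
theorem QuaternionAlgebra.nonempty_algEquiv_matrix {F : Type*} [Field F] (h2 : (2 : F) ≠ 0)
    {a b u v : F} (ha : a ≠ 0) (hb : b ≠ 0) (h : b = u ^ 2 - a * v ^ 2) :
    Nonempty (ℍ[F, a, b] ≃ₐ[F] Matrix (Fin 2) (Fin 2) F) := by
  let q : QuaternionAlgebra.Basis (Matrix (Fin 2) (Fin 2) F) a 0 b :=
    { i := !![0, a; 1, 0]
      j := !![u, -a * v; v, -u]
      k := !![a * v, -a * u; u, -a * v]
      i_mul_i := by
        ext i j
        fin_cases i <;> fin_cases j <;> simp [Matrix.mul_apply, Fin.sum_univ_two]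
      j_mul_j := by
        ext i j
        fin_cases i <;> fin_cases j <;> simp [Matrix.mul_apply, Fin.sum_univ_two, h] <;> ring
      i_mul_j := by
        ext i j
        fin_cases i <;> fin_cases j <;> simp [Matrix.mul_apply, Fin.sum_univ_two]
      j_mul_i := by
        ext i j
        fin_cases i <;> fin_cases j <;> simp [Matrix.mul_apply, Fin.sum_univ_two] <;> ring }
  have hinj : Function.Injective q.liftHom := by
    rw [injective_iff_map_eq_zero]
    rintro ⟨x, y, z, w⟩ hq
    have e (i j) := congrFun (congrFun hq i) j
    have e00 := e 0 0
    have e01 := e 0 1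
    have e10 := e 1 0
    have e11 := e 1 1
    simp [q, QuaternionAlgebra.Basis.liftHom, QuaternionAlgebra.Basis.lift,
      Matrix.algebraMap_matrix_apply] at e00 e01 e10 e11
    have hx : x = 0 := mul_left_cancel₀ h2 (by linear_combination e00 + e11)
    have hy : y = 0 := by
      refine mul_left_cancel₀ (mul_ne_zero h2 ha) ?_
      linear_combination e01 + a * e10
    subst hx hy
    have hz : z = 0 := by
      refine mul_left_cancel₀ hb ?_
      rw [h]
      linear_combination u * e00 - a * v * e10
    have hw : w = 0 := by
      refine mul_left_cancel₀ hb ?_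
      rw [h]
      linear_combination u * e10 - v * e00
    subst hz hw
    rfl
  have hrank : Module.finrank F ℍ[F, a, b] = Module.finrank F (Matrix (Fin 2) (Fin 2) F) := by
    rw [QuaternionAlgebra.finrank_eq_four, Module.finrank_matrix]
    simp
  have hsurj : Function.Surjective q.liftHom :=
    (LinearMap.injective_iff_surjective_of_finrank_eq_finrank (f := q.liftHom.toLinearMap)
      hrank).1 hinj
  exact ⟨AlgEquiv.ofBijective q.liftHom ⟨hinj, hsurj⟩⟩

/-- If a quaternion algebra is split and `a` is not a square, then `b` is a norm from `F(√a)`. -/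
theorem QuaternionAlgebra.exists_eq_sq_sub_mul_sq {F : Type*} [Field F] (h2 : (2 : F) ≠ 0)
    {a b : F} (ha : ¬ IsSquare a) (f : ℍ[F, a, b] ≃ₐ[F] Matrix (Fin 2) (Fin 2) F) :
    ∃ u v : F, b = u ^ 2 - a * v ^ 2 := by
  obtain ⟨q, hq0, hqq⟩ : ∃ q : ℍ[F, a, b], q ≠ 0 ∧ q * q = 0 := by
    refine ⟨f.symm !![0, 1; 0, 0], ?_, ?_⟩
    · rw [Ne, EmbeddingLike.map_eq_zero_iff]
      intro h
      simpa using congrFun (congrFun h 0) 1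
    · rw [← map_mul, EmbeddingLike.map_eq_zero_iff]
      ext i j
      fin_cases i <;> fin_cases j <;> simp [Matrix.mul_apply]
  obtain ⟨x, y, z, w⟩ := q
  have hre := congrArg QuaternionAlgebra.re hqq
  have hi := congrArg QuaternionAlgebra.imI hqq
  have hj := congrArg QuaternionAlgebra.imJ hqq
  have hk := congrArg QuaternionAlgebra.imK hqq
  simp only [QuaternionAlgebra.mk_mul_mk, QuaternionAlgebra.re_zero, QuaternionAlgebra.imI_zero,
    QuaternionAlgebra.imJ_zero, QuaternionAlgebra.imK_zero] at hre hi hj hk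
  have hx : x = 0 := by
    by_contra hx
    have hy : y = 0 := mul_left_cancel₀ (mul_ne_zero h2 hx) (by linear_combination hi)
    have hz : z = 0 := mul_left_cancel₀ (mul_ne_zero h2 hx) (by linear_combination hj)
    have hw : w = 0 := mul_left_cancel₀ (mul_ne_zero h2 hx) (by linear_combination hk)
    subst hy hz hw
    exact hx (by simpa using hre)
  subst hx
  have hD : z ^ 2 - a * w ^ 2 ≠ 0 := by
    intro hD
    have hw : w = 0 := by
      by_contra hw
      refine ha ⟨z / w, ?_⟩
      field_simp
      linear_combination -hD
    subst hw
    have hz : z = 0 := by simpa using hD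
    subst hz
    have ha0 : a ≠ 0 := by
      rintro rfl
      exact ha IsSquare.zero
    have hy : y = 0 := by simpa [ha0] using hre
    subst hy
    exact hq0 rfl
  refine ⟨a * y * w / (z ^ 2 - a * w ^ 2), y * z / (z ^ 2 - a * w ^ 2), ?_⟩
  field_simp
  linear_combination (z ^ 2 - a * w ^ 2) * hre

/-- A natural number that is a square modulo each prime divisor of a squarefree `n` is a square
modulo `n`. -/
theorem ZMod.isSquare_natCast_of_squarefree {a n : ℕ} (hn : Squarefree n)
    (h : ∀ p : ℕ, p.Prime → p ∣ n → IsSquare (a : ZMod p)) : IsSquare (a : ZMod n) := by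
  induction n using Nat.recOnPosPrimePosCoprime with
  | prime_pow p k hp hk =>
    have : k = 1 := by
      rcases (Nat.squarefree_pow_iff hp.ne_one hk.ne').1 hn with ⟨-, h1⟩
      exact h1
    subst this
    rw [pow_one] at h ⊢
    exact h p hp dvd_rfl
  | zero => exact absurd hn not_squarefree_zero
  | one => exact ⟨0, Subsingleton.elim _ _⟩
  | coprime m n hm hn' hco ihm ihn =>
    obtain ⟨r, hr⟩ := ihm (hn.of_mul_left) fun p hp hd ↦ h p hp (hd.mul_right n)
    obtain ⟨s, hs⟩ := ihn (hn.of_mul_right) fun p hp hd ↦ h p hp (hd.mul_left m)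
    let e := ZMod.chineseRemainder hco
    refine ⟨e.symm (r, s), e.injective ?_⟩
    rw [map_mul, RingEquiv.apply_symm_apply, map_natCast]
    exact Prod.ext hr hs

/-- Let `a, b` be positive integers with `b` odd and Jacobi symbol
`J(a | b) = 1`.  Let `ℓ` be an odd prime such that `ℓ·b` is a square unit modulo `a`
and such that the Legendre symbol `(a/ℓ) = 1`.  Then `ℍ[ℚ, a, ℓ·b] ≅ M₂(ℚ)` as
`ℚ`-algebras if and only if `a` is a square modulo every prime `p` dividing `b` to odd
exponent. -/
theorem rational_quaternion_isMatrixRing_iff_residue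
    (a b : ℕ) (hapos : 0 < a) (hbpos : 0 < b) (hbodd : Odd b)
    (hJ : J((a : ℤ) | b) = 1)
    (ℓ : ℕ) [Fact ℓ.Prime] (hℓodd : Odd ℓ)
    (hsq : ∃ c : (ZMod a)ˣ, ((c : ZMod a)) ^ 2 = ((ℓ * b : ℕ) : ZMod a))
    (hleg : legendreSym ℓ (a : ℤ) = 1) :
    Nonempty (ℍ[ℚ, (a : ℚ), ((ℓ * b : ℕ) : ℚ)] ≃ₐ[ℚ] Matrix (Fin 2) (Fin 2) ℚ) ↔
      ∀ p : ℕ, p.Prime → Odd (b.factorization p) → IsSquare ((a : ZMod p)) := by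
  have hℓ : ℓ.Prime := Fact.out
  have hB0 : 0 < ℓ * b := Nat.mul_pos hℓ.pos hbpos
  have hsqℓ : IsSquare ((a : ℕ) : ZMod ℓ) := by
    have ha0 : ((a : ℤ) : ZMod ℓ) ≠ 0 := fun h0 ↦ by
      rw [(legendreSym.eq_zero_iff ℓ a).2 h0] at hleg
      exact zero_ne_one hleg
    simpa using (legendreSym.eq_one_iff ℓ ha0).1 hleg
  obtain ⟨c, hc⟩ := hsq
  have hunit : IsUnit ((ℓ * b : ℕ) : ZMod a) := hc ▸ (c.isUnit.pow 2)
  obtain ⟨B, n, hBpos, hnpos, hBn, hBsf⟩ := Nat.sq_mul_squarefree_of_pos hB0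
  have hcoB : a.Coprime B := by
    have h := ((ZMod.isUnit_iff_coprime _ _).1 hunit).symm
    rw [← hBn] at h
    exact h.coprime_mul_left_right
  have hodd {p : ℕ} (hp : p.Prime) (hpℓ : p ≠ ℓ) : p ∣ B ↔ Odd (b.factorization p) := by
    have h1 : (ℓ * b).factorization p = b.factorization p := by
      rw [Nat.factorization_mul hℓ.ne_zero hbpos.ne', hℓ.factorization]
      simp [hpℓ.symm]
    have h2 : (ℓ * b).factorization p = 2 * n.factorization p + B.factorization p := by
      rw [← hBn, Nat.factorization_mul (by positivity) hBpos.ne', Nat.factorization_pow]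
      simp
    have h3 : B.factorization p ≤ 1 := hBsf.natFactorization_le_one p
    rw [hp.dvd_iff_one_le_factorization hBpos.ne', ← h1, h2, Nat.odd_iff]
    omega
  have hnQ : (n : ℚ) ≠ 0 := by exact_mod_cast hnpos.ne'
  have hBnQ : ((ℓ * b : ℕ) : ℚ) = n ^ 2 * B := by exact_mod_cast hBn.symm
  constructor
  · rintro ⟨f⟩ p hp hpb
    by_cases hpℓ : p = ℓ
    · exact hpℓ ▸ hsqℓ
    by_contra hns
    have hnsQ : ¬ IsSquare (a : ℚ) := by
      rw [Rat.isSquare_natCast_iff]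
      rintro ⟨r, rfl⟩
      exact hns ⟨r, by push_cast; rfl⟩
    obtain ⟨u, v, huv⟩ := QuaternionAlgebra.exists_eq_sq_sub_mul_sq two_ne_zero hnsQ f
    have hu : (u.den : ℚ) ≠ 0 := by exact_mod_cast u.den_ne_zero
    have hv : (v.den : ℚ) ≠ 0 := by exact_mod_cast v.den_ne_zero
    have key : (B : ℤ) * (n * u.den * v.den) ^ 2 =
        (u.num * v.den) ^ 2 - a * (v.num * u.den) ^ 2 := by
      rw [hBnQ, ← Rat.num_div_den u, ← Rat.num_div_den v] at huv
      field_simp at huv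
      have : (B : ℚ) * (n * u.den * v.den) ^ 2 =
          (u.num * v.den) ^ 2 - a * (v.num * u.den) ^ 2 := by
        linear_combination huv
      exact_mod_cast this
    have h0 := eq_zero_of_mul_sq_eq_sq_sub_mul_sq hp ((hodd hp hpℓ).2 hpb)
      (fun hd ↦ hp.ne_one (Nat.isUnit_iff.1 (hBsf p (by rwa [← sq])))) hns key
    have : (n : ℤ) * u.den * v.den ≠ 0 := by
      have := u.den_ne_zero
      have := v.den_ne_zero
      positivity
    exact this h0
  · intro h
    have hs : IsSquare (a : ZMod B) := by
      refine ZMod.isSquare_natCast_of_squarefree hBsf fun p hp hpB ↦ ?_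
      by_cases hpℓ : p = ℓ
      · exact hpℓ ▸ hsqℓ
      · exact h p hp ((hodd hp hpℓ).1 hpB)
    have ht : IsSquare (B : ZMod a) := by
      rw [← hBn] at hc hunit
      push_cast at hc hunit
      obtain ⟨m, hm⟩ := (isUnit_pow_iff two_ne_zero).1 (isUnit_of_mul_isUnit_left hunit)
      refine ⟨c * ↑m⁻¹, ?_⟩
      have hmm : (n : ZMod a) * ↑m⁻¹ = 1 := by rw [← hm, Units.mul_inv]
      linear_combination (-(B : ZMod a)) * (n * ↑m⁻¹ + 1) * hmm - (↑m⁻¹ : ZMod a) ^ 2 * hc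
    obtain ⟨u, v, huv⟩ := exists_eq_sq_sub_mul_sq_of_coprime hapos hBpos hcoB hs ht
    refine QuaternionAlgebra.nonempty_algEquiv_matrix two_ne_zero (u := n * u) (v := n * v)
      (by exact_mod_cast hapos.ne') (by exact_mod_cast hB0.ne') ?_
    rw [hBnQ, huv]
    ring
end
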